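/- Let p = (p_1,…,p_d) be a non-uniform probability distribution with all p_i > 0 (so V(p) > 0), let ε ∈ (0,1), and let c > 0, where c is arbitrary if the family {log p_i} is non-lattice, and c equals the lattice span if it is a lattice family. For each n set R_{0,n} = { x⃗ ∈ {1,…,d}^n : n·H(p) + √n·√V(p)·Φ^{−1}(ε) ≥ −log P^n(x⃗) > n·H(p) + √n·√V(p)·Φ^{−1}(ε) − c }. Then there exist a constant C and an integer N such that for all n ≥ N, | log |R_{0,n}| − ( n·H(p) + √n·√V(p)·Φ^{−1}(ε) − (1/2)·log n ) | ≤ C. -/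

import Mathlib

open scoped BigOperators Classical
open Real

/-- Shannon entropy (natural log). -/
noncomputable def shannonH {d : ℕ} (p : Fin d → ℝ) : ℝ :=
  -∑ i, p i * Real.log (p i)

/-- Varentropy `V(p)`. -/
noncomputable def varH {d : ℕ} (p : Fin d → ℝ) : ℝ :=
  ∑ i, p i * (Real.log (p i) + shannonH p) ^ 2

/-- CDF of the standard normal distribution. -/
noncomputable def Phi (x : ℝ) : ℝ :=
  ∫ y in Set.Iic x, Real.exp (-(y ^ 2) / 2) / Real.sqrt (2 * Real.pi)

/-- Inverse of the standard normal CDF. -/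
noncomputable def PhiInv : ℝ → ℝ := Function.invFun Phi

/-- Product probability `P^n(x)` of a string. -/
noncomputable def prodP {d : ℕ} (p : Fin d → ℝ) {n : ℕ} (x : Fin n → Fin d) : ℝ :=
  ∏ k, p (x k)

/-- `c₀` is the lattice span of the family `{log p_i}`: the largest positive real
such that all differences `log p_i − log p_j` lie in `c₀ ⬝ ℤ`. -/
def IsLatticeSpan {d : ℕ} (p : Fin d → ℝ) (c₀ : ℝ) : Prop :=
  0 < c₀ ∧ (∀ i j, ∃ k : ℤ, Real.log (p i) - Real.log (p j) = (k : ℝ) * c₀) ∧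
    ∀ c' : ℝ, 0 < c' →
      (∀ i j, ∃ k : ℤ, Real.log (p i) - Real.log (p j) = (k : ℝ) * c') → c' ≤ c₀

/-- The slab `R_{k,n}` of strings whose self-information lies in the `k`-th window
of width `c` below `n·H(p) + √n·√V(p)·Φ⁻¹(ε)`. -/
noncomputable def Rslab {d : ℕ} (p : Fin d → ℝ) (ε c : ℝ) (n k : ℕ) :
    Finset (Fin n → Fin d) :=
  Finset.univ.filter (fun x =>
    -Real.log (prodP p x)
        ≤ (n : ℝ) * shannonH p + Real.sqrt n * Real.sqrt (varH p) * PhiInv ε - c * k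
      ∧ (n : ℝ) * shannonH p + Real.sqrt n * Real.sqrt (varH p) * PhiInv ε - c * (k + 1)
        < -Real.log (prodP p x))

/-- The type (vector of symbol counts) of a string. -/
def strType {d n : ℕ} (x : Fin n → Fin d) : Fin d → ℤ :=
  fun a => ∑ k, if x k = a then 1 else 0

/-- The probability of the type class `N`. -/
noncomputable def typeProb {d : ℕ} (p : Fin d → ℝ) (n : ℕ) (N : Fin d → ℤ) : ℝ :=
  ∑ x : Fin n → Fin d, if strType x = N then prodP p x else 0

/-- The probability that the type of a random string satisfies `Q`. -/
noncomputable def probType {d : ℕ} (p : Fin d → ℝ) (n : ℕ) (Q : (Fin d → ℤ) → Prop) : ℝ :=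
  ∑ x : Fin n → Fin d, if Q (strType x) then prodP p x else 0

/-- The change of type caused by replacing one symbol `b` by `a`. -/
def swapVec {d : ℕ} (a b : Fin d) : Fin d → ℤ := Pi.single a 1 - Pi.single b 1

section Basic

variable {d n : ℕ} {p : Fin d → ℝ}

lemma prodP_pos (hpos : ∀ i, 0 < p i) (x : Fin n → Fin d) : 0 < prodP p x :=
  Finset.prod_pos fun k _ => hpos (x k)

lemma typeProb_nonneg (hpos : ∀ i, 0 < p i) (N : Fin d → ℤ) : 0 ≤ typeProb p n N :=
  Finset.sum_nonneg fun x _ => by split_ifs <;> [exact (prodP_pos hpos x).le; rfl]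

lemma strType_nonneg (x : Fin n → Fin d) (a : Fin d) : 0 ≤ strType x a :=
  Finset.sum_nonneg fun k _ => by split_ifs <;> simp

lemma prodP_update (x : Fin n → Fin d) (k : Fin n) (a : Fin d) :
    prodP p (Function.update x k a) * p (x k) = prodP p x * p a := by
  unfold prodP
  rw [← Finset.mul_prod_erase _ _ (Finset.mem_univ k),
    ← Finset.mul_prod_erase _ (fun i => p (x i)) (Finset.mem_univ k)]
  have : ∏ i ∈ Finset.univ.erase k, p (Function.update x k a i)
      = ∏ i ∈ Finset.univ.erase k, p (x i) :=
    Finset.prod_congr rfl fun i hi => by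
      rw [Function.update_of_ne (Finset.ne_of_mem_erase hi)]
  rw [this, Function.update_self]
  ring

lemma strType_update (x : Fin n → Fin d) (k : Fin n) (a : Fin d) :
    strType (Function.update x k a) = strType x + swapVec a (x k) := by
  funext e
  unfold strType swapVec
  simp only [Pi.add_apply, Pi.sub_apply]
  rw [← Finset.add_sum_erase _ _ (Finset.mem_univ k),
    ← Finset.add_sum_erase _ (fun i => if x i = e then (1 : ℤ) else 0) (Finset.mem_univ k)]
  have : ∑ i ∈ Finset.univ.erase k, (if Function.update x k a i = e then (1 : ℤ) else 0)
      = ∑ i ∈ Finset.univ.erase k, if x i = e then (1 : ℤ) else 0 :=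
    Finset.sum_congr rfl fun i hi => by
      rw [Function.update_of_ne (Finset.ne_of_mem_erase hi)]
  rw [this, Function.update_self]
  simp only [Pi.single_apply, eq_comm (a := e)]
  ring

lemma typeProb_mul_count (N : Fin d → ℤ) (b : Fin d) :
    typeProb p n N * N b
      = ∑ k : Fin n, ∑ x : Fin n → Fin d,
          if strType x = N ∧ x k = b then prodP p x else 0 := by
  rw [Finset.sum_comm, typeProb, Finset.sum_mul]
  refine Finset.sum_congr rfl fun x _ => ?_
  by_cases h : strType x = N
  · simp only [h, if_true, true_and]
    rw [← h]
    unfold strType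
    push_cast
    rw [Finset.mul_sum]
    exact Finset.sum_congr rfl fun k _ => by split_ifs <;> simp
  · simp [h]

lemma typeProb_swap (N : Fin d → ℤ) {a b : Fin d} (hab : a ≠ b) :
    typeProb p n N * N b * p a = typeProb p n (N + swapVec a b) * (N a + 1) * p b := by
  have h1 := typeProb_mul_count (p := p) (n := n) (N + swapVec a b) a
  have h2 : (((N + swapVec a b) a : ℤ) : ℝ) = N a + 1 := by
    simp [swapVec, hab]
  rw [h2] at h1
  rw [h1, typeProb_mul_count, Finset.sum_mul, Finset.sum_mul]
  refine Finset.sum_congr rfl fun k _ => ?_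
  rw [← Finset.sum_filter, ← Finset.sum_filter, Finset.sum_mul, Finset.sum_mul]
  refine Finset.sum_nbij' (fun x => Function.update x k a) (fun x => Function.update x k b)
    ?_ ?_ ?_ ?_ ?_
  · intro x hx
    simp only [Finset.mem_filter, Finset.mem_univ, true_and] at hx ⊢
    rw [strType_update, hx.1, hx.2]
    simp
  · intro x hx
    simp only [Finset.mem_filter, Finset.mem_univ, true_and] at hx ⊢
    rw [strType_update, hx.1, hx.2, swapVec, swapVec]
    simp only [Function.update_self, and_true]
    abel
  · intro x hx
    simp only [Finset.mem_filter, Finset.mem_univ, true_and] at hx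
    simp [← hx.2]
  · intro x hx
    simp only [Finset.mem_filter, Finset.mem_univ, true_and] at hx
    simp [← hx.2]
  · intro x hx
    simp only [Finset.mem_filter, Finset.mem_univ, true_and] at hx
    rw [← hx.2, prodP_update]

lemma sum_typeProb (A : Finset (Fin d → ℤ)) :
    ∑ N ∈ A, typeProb p n N = probType p n (· ∈ A) := by
  unfold typeProb probType
  rw [Finset.sum_comm]
  refine Finset.sum_congr rfl fun x _ => ?_
  simp

lemma probType_mono (hpos : ∀ i, 0 < p i) {Q R : (Fin d → ℤ) → Prop}
    (h : ∀ x : Fin n → Fin d, Q (strType x) → R (strType x)) :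
    probType p n Q ≤ probType p n R := by
  refine Finset.sum_le_sum fun x _ => ?_
  have := (prodP_pos hpos x).le
  have := h x
  split_ifs <;> simp_all

lemma sum_typeProb_le (hpos : ∀ i, 0 < p i) (A : Finset (Fin d → ℤ))
    {Q : (Fin d → ℤ) → Prop} (h : ∀ N ∈ A, Q N) :
    ∑ N ∈ A, typeProb p n N ≤ probType p n Q := by
  rw [sum_typeProb]
  exact probType_mono hpos fun x hx => h _ hx

lemma exists_probType_eq_sum (n : ℕ) (p : Fin d → ℝ) (Q : (Fin d → ℤ) → Prop) :
    ∃ F : Finset (Fin d → ℤ), (∀ N ∈ F, (∃ x : Fin n → Fin d, strType x = N) ∧ Q N) ∧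
      probType p n Q = ∑ N ∈ F, typeProb p n N := by
  refine ⟨(Finset.univ.image (strType (n := n))).filter Q, fun N hN => ?_, ?_⟩
  · simpa using hN
  · rw [sum_typeProb]
    refine Finset.sum_congr rfl fun x _ => ?_
    simp

lemma probType_le_add (hpos : ∀ i, 0 < p i) {Q R S : (Fin d → ℤ) → Prop}
    (h : ∀ x : Fin n → Fin d, Q (strType x) → R (strType x) ∨ S (strType x)) :
    probType p n Q ≤ probType p n R + probType p n S := by
  unfold probType
  rw [← Finset.sum_add_distrib]
  refine Finset.sum_le_sum fun x _ => ?_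
  have := (prodP_pos hpos x).le
  have := h x
  split_ifs <;> simp_all

lemma sum_prodP (hsum : ∑ i, p i = 1) (n : ℕ) : ∑ x : Fin n → Fin d, prodP p x = 1 := by
  have := (Finset.prod_univ_sum (fun _ : Fin n => (Finset.univ : Finset (Fin d)))
    (fun _ a => p a)).symm
  simpa [prodP, hsum] using this

lemma sum_prodP_mul_sq (hsum : ∑ i, p i = 1) (Y : Fin d → ℝ) (hY : ∑ i, p i * Y i = 0) (n : ℕ) :
    ∑ x : Fin n → Fin d, prodP p x * (∑ k, Y (x k)) ^ 2 = n * ∑ i, p i * Y i ^ 2 := by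
  induction n with
  | zero => simp
  | succ n ih =>
    rw [← (Fin.consEquiv (fun _ : Fin (n + 1) => Fin d)).sum_comp, Fintype.sum_prod_type]
    have h : ∀ (a : Fin d) (y : Fin n → Fin d),
        prodP p (Fin.consEquiv (fun _ : Fin (n + 1) => Fin d) (a, y))
            * (∑ k, Y (Fin.consEquiv (fun _ : Fin (n + 1) => Fin d) (a, y) k)) ^ 2
          = (p a * Y a ^ 2) * prodP p y + 2 * (p a * Y a) * (prodP p y * ∑ k, Y (y k))
            + p a * (prodP p y * (∑ k, Y (y k)) ^ 2) := by
      intro a y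
      simp only [Fin.consEquiv, prodP, Equiv.coe_fn_mk, Fin.prod_univ_succ, Fin.sum_univ_succ,
        Fin.cons_zero, Fin.cons_succ]
      ring
    simp only [h, Finset.sum_add_distrib, ← Finset.mul_sum, ← Finset.sum_mul, ih, hY, hsum,
      sum_prodP hsum]
    push_cast
    ring

lemma probType_deviation_le (hpos : ∀ i, 0 < p i) (hsum : ∑ i, p i = 1) (i : Fin d) {t : ℝ}
    (ht : 0 < t) :
    probType p n (fun N => t ≤ |(N i : ℝ) - n * p i|) ≤ n / t ^ 2 := by
  have hle : p i ≤ 1 := hsum ▸ Finset.single_le_sum (fun j _ => (hpos j).le) (Finset.mem_univ i)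
  set Y : Fin d → ℝ := fun a => (if a = i then 1 else 0) - p i with hYdef
  have hY : ∑ a, p a * Y a = 0 := by
    simp [hYdef, mul_sub, Finset.sum_sub_distrib, ← Finset.sum_mul, hsum]
  have hY2 : ∑ a, p a * Y a ^ 2 ≤ 1 := by
    rw [← hsum]
    refine Finset.sum_le_sum fun a _ => ?_
    have : Y a ^ 2 ≤ 1 := by
      have := hpos i
      simp only [hYdef]
      split_ifs <;> nlinarith
    nlinarith [hpos a]
  have key := sum_prodP_mul_sq hsum Y hY n
  rw [le_div_iff₀ (by positivity)]
  calc probType p n (fun N => t ≤ |(N i : ℝ) - n * p i|) * t ^ 2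
      ≤ ∑ x : Fin n → Fin d, prodP p x * (∑ k, Y (x k)) ^ 2 := by
        unfold probType
        rw [Finset.sum_mul]
        refine Finset.sum_le_sum fun x _ => ?_
        have hx : ∑ k, Y (x k) = (strType x i : ℝ) - n * p i := by
          simp [hYdef, strType, Finset.sum_sub_distrib]
        have hP := (prodP_pos hpos x).le
        rw [hx]
        split_ifs with h
        · refine mul_le_mul_of_nonneg_left ?_ hP
          rw [← sq_abs ((strType x i : ℝ) - n * p i)]
          exact pow_le_pow_left₀ ht.le h 2
        · rw [zero_mul]; positivity
    _ ≤ n := by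
        rw [key]
        nlinarith [(Nat.cast_nonneg n : (0 : ℝ) ≤ n)]

end Basic

section Ratio

variable {d : ℕ} {p : Fin d → ℝ}

lemma pow_mul_typeProb_le (hpos : ∀ i, 0 < p i) {n : ℕ} {a b : Fin d} (hab : a ≠ b) {r : ℝ}
    (hr : 0 ≤ r) {N : Fin d → ℤ} (hN : 0 ≤ N a) (k : ℕ)
    (h : ∀ l : ℕ, l < k → r * ((N a + 1 + l) * p b) ≤ (N b - l) * p a) :
    r ^ k * typeProb p n N ≤ typeProb p n (N + (k : ℤ) • swapVec a b) := by
  induction k with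
  | zero => simp
  | succ k ih =>
    have ih := ih fun l hl => h l (by omega)
    have hk := h k (by omega)
    have hswap := typeProb_swap (p := p) (n := n) (N + (k : ℤ) • swapVec a b) hab
    have e1 : (((N + (k : ℤ) • swapVec a b) a : ℤ) : ℝ) = N a + k := by
      simp [swapVec, hab]
    have e2 : (((N + (k : ℤ) • swapVec a b) b : ℤ) : ℝ) = N b - k := by
      simp [swapVec, hab.symm, sub_eq_add_neg]
    have e3 : N + (k : ℤ) • swapVec a b + swapVec a b
        = N + ((k + 1 : ℕ) : ℤ) • swapVec a b := by
      push_cast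
      rw [add_smul, one_smul, add_assoc]
    rw [e1, e2, e3] at hswap
    have hNa : (0 : ℝ) ≤ N a := by exact_mod_cast hN
    have hden : 0 < ((N a : ℝ) + 1 + k) * p b := mul_pos (by positivity) (hpos b)
    have hW := typeProb_nonneg (n := n) hpos N
    refine le_of_mul_le_mul_right ?_ hden
    calc r ^ (k + 1) * typeProb p n N * ((N a + 1 + k) * p b)
        = (r ^ k * typeProb p n N) * (r * ((N a + 1 + k) * p b)) := by ring
      _ ≤ typeProb p n (N + (k : ℤ) • swapVec a b) * ((N b - k) * p a) := by
          refine mul_le_mul ih hk (by positivity) (typeProb_nonneg hpos _)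
      _ = _ := by rw [← mul_assoc, hswap]; ring

lemma exists_swap_ratio (hpos : ∀ i, 0 < p i) {a b : Fin d} (hab : a ≠ b) {η D A : ℝ}
    (hη : 0 < η) (hD : 0 ≤ D) (hA : 0 ≤ A) :
    ∃ κ > 0, ∃ N₀ : ℕ, ∀ n ≥ N₀, ∀ N : Fin d → ℤ, 0 ≤ N a → η * n ≤ N b →
      N a * p b - N b * p a ≤ D * √n → ∀ k : ℕ, k ≤ A * √n →
      κ * typeProb p n N ≤ typeProb p n (N + (k : ℤ) • swapVec a b) := by
  have ha := hpos a
  have hb := hpos b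
  set s : ℝ := 2 * (D + A * (p a + p b)) / (η * p a) with hs
  have hs0 : 0 ≤ s := by positivity
  refine ⟨Real.exp (-(s * A)), Real.exp_pos _, ⌈(2 * A / η) ^ 2⌉₊ + 1, ?_⟩
  intro n hn N hNa hNb hdiff k hk
  have hn1 : (1 : ℝ) ≤ n := by exact_mod_cast (by omega : 1 ≤ n)
  have hq : 0 < √(n : ℝ) := Real.sqrt_pos.2 (by linarith)
  have hqq : √(n : ℝ) * √n = n := Real.mul_self_sqrt (by linarith)
  have hq2 : 2 * A ≤ η * √n := by
    have : (2 * A / η) ^ 2 ≤ n :=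
      (Nat.le_ceil _).trans (by exact_mod_cast (by omega : ⌈(2 * A / η) ^ 2⌉₊ ≤ n))
    have := Real.le_sqrt_of_sq_le this
    rw [div_le_iff₀ hη] at this
    linarith
  have hlarge : A * √n ≤ η / 2 * n := by
    have := mul_le_mul_of_nonneg_right hq2 hq.le
    rw [mul_assoc η, hqq] at this
    linarith
  have hx : 0 ≤ s / √n := by positivity
  have hr : 0 < 1 + s / √n := by linarith
  have hpow : Real.exp (-(s * A)) ≤ ((1 + s / √n)⁻¹) ^ k := by
    rw [inv_pow, Real.exp_neg]
    refine inv_anti₀ (by positivity) ?_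
    calc (1 + s / √n) ^ k ≤ (Real.exp (s / √n)) ^ k := by
          gcongr
          linarith [Real.add_one_le_exp (s / √n)]
      _ = Real.exp (k * (s / √n)) := by rw [← Real.exp_nat_mul]
      _ ≤ Real.exp (s * A) := by
          rw [Real.exp_le_exp, mul_div_assoc', div_le_iff₀ hq]
          nlinarith
  refine (mul_le_mul_of_nonneg_right hpow (typeProb_nonneg hpos N)).trans ?_
  refine pow_mul_typeProb_le hpos hab (by positivity) hNa k fun l hl => ?_
  have hl1 : (l : ℝ) + 1 ≤ A * √n := le_trans (by exact_mod_cast hl) hk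
  rw [inv_mul_le_iff₀ hr]
  have key : (D + A * (p a + p b)) * √n ≤ s / √n * ((N b - l) * p a) := by
    have h1 : η / 2 * n * p a ≤ (N b - l) * p a := by
      gcongr; linarith
    have h2 : s / √n * (η / 2 * n * p a) = (D + A * (p a + p b)) * √n := by
      rw [hs]
      field_simp
      rw [sq, hqq]
    calc _ = s / √n * (η / 2 * n * p a) := h2.symm
      _ ≤ _ := by gcongr
  nlinarith

lemma exists_swap_ratio_central (hpos : ∀ i, 0 < p i) (a b : Fin d) {A B : ℝ}
    (hA : 0 ≤ A) (hB : 0 ≤ B) :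
    ∃ κ > 0, ∃ N₀ : ℕ, ∀ n ≥ N₀, ∀ N : Fin d → ℤ, (∀ i, |N i - n * p i| ≤ B * √n) →
      ∀ m : ℤ, |(m : ℝ)| ≤ A * √n →
      κ * typeProb p n N ≤ typeProb p n (N + m • swapVec a b) := by
  by_cases hab : a = b
  · subst hab
    exact ⟨1, one_pos, 0, fun n _ N _ m _ => by simp [swapVec]⟩
  have ha := hpos a
  have hb := hpos b
  have hD : 0 ≤ B * (p a + p b) := by positivity
  obtain ⟨κ₁, hκ₁, N₁, h₁⟩ := exists_swap_ratio hpos hab (half_pos hb) hD hA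
  obtain ⟨κ₂, hκ₂, N₂, h₂⟩ := exists_swap_ratio hpos (Ne.symm hab) (half_pos ha) hD hA
  refine ⟨min κ₁ κ₂, lt_min hκ₁ hκ₂,
    N₁ + N₂ + ⌈(2 * B / p a) ^ 2⌉₊ + ⌈(2 * B / p b) ^ 2⌉₊, ?_⟩
  intro n hn N hN m hm
  have hqq : √(n : ℝ) * √n = n := Real.mul_self_sqrt (by positivity)
  have hq0 : 0 ≤ √(n : ℝ) := Real.sqrt_nonneg _
  have large : ∀ i, ⌈(2 * B / p i) ^ 2⌉₊ ≤ n → p i / 2 * n ≤ N i := by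
    intro i hi
    have h1 : (2 * B / p i) ^ 2 ≤ n := (Nat.le_ceil _).trans (by exact_mod_cast hi)
    have h2 := Real.le_sqrt_of_sq_le h1
    rw [div_le_iff₀ (hpos i)] at h2
    have h3 : 2 * B * √n ≤ p i * n := by
      calc 2 * B * √n ≤ √n * p i * √n := mul_le_mul_of_nonneg_right h2 hq0
        _ = p i * n := by rw [mul_comm (√(n : ℝ)), mul_assoc, hqq]
    have := (abs_le.1 (hN i)).1
    linarith
  have hNa := large a (by omega)
  have hNb := large b (by omega)
  have hNa0 : 0 ≤ N a := by
    have : (0 : ℝ) ≤ N a := le_trans (by positivity) hNa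
    exact_mod_cast this
  have hNb0 : 0 ≤ N b := by
    have : (0 : ℝ) ≤ N b := le_trans (by positivity) hNb
    exact_mod_cast this
  have hA' := abs_le.1 (hN a)
  have hB' := abs_le.1 (hN b)
  have hW := typeProb_nonneg (n := n) hpos N
  rcases le_total 0 m with h0 | h0
  · lift m to ℕ using h0
    refine (mul_le_mul_of_nonneg_right (min_le_left _ _) hW).trans
      (h₁ n (by omega) N hNa0 hNb ?_ m (by simpa using hm))
    nlinarith
  · obtain ⟨k, rfl⟩ : ∃ k : ℕ, m = -(k : ℤ) := ⟨m.natAbs, by omega⟩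
    have e : -(k : ℤ) • swapVec a b = (k : ℤ) • swapVec b a := by
      rw [neg_smul, ← smul_neg, swapVec, swapVec, neg_sub]
    rw [e]
    refine (mul_le_mul_of_nonneg_right (min_le_right _ _) hW).trans
      (h₂ n (by omega) N hNb0 hNa ?_ k (by simpa using hm))
    nlinarith

lemma exists_shift_ratio_central (hpos : ∀ i, 0 < p i) (o : Fin d) {A : ℝ} (hA : 0 ≤ A)
    (s : Finset (Fin d)) :
    ∀ {B : ℝ}, 0 ≤ B → ∃ κ > 0, ∃ N₀ : ℕ, ∀ n ≥ N₀, ∀ N : Fin d → ℤ,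
      (∀ i, |N i - n * p i| ≤ B * √n) → ∀ m : Fin d → ℤ, (∀ a, |(m a : ℝ)| ≤ A * √n) →
      κ * typeProb p n N ≤ typeProb p n (N + ∑ a ∈ s, m a • swapVec a o) := by
  induction s using Finset.induction_on with
  | empty => exact fun _ => ⟨1, one_pos, 0, fun n _ N _ m _ => by simp⟩
  | insert a s has ih =>
    intro B hB
    obtain ⟨κ₁, hκ₁, N₁, h₁⟩ := exists_swap_ratio_central hpos a o hA hB
    obtain ⟨κ₂, hκ₂, N₂, h₂⟩ := ih (B := B + A) (by positivity)
    refine ⟨κ₂ * κ₁, by positivity, N₁ + N₂, fun n hn N hN m hm => ?_⟩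
    have hN' : ∀ i, |(((N + m a • swapVec a o) i : ℤ) : ℝ) - n * p i| ≤ (B + A) * √n := by
      intro i
      have h1 : |((swapVec a o i : ℤ) : ℝ)| ≤ 1 := by
        simp only [swapVec, Pi.sub_apply, Pi.single_apply]
        split_ifs <;> simp
      have h2 : (((N + m a • swapVec a o) i : ℤ) : ℝ) - n * p i
          = (N i - n * p i) + m a * (swapVec a o i : ℤ) := by
        simp only [Pi.add_apply, Pi.smul_apply, smul_eq_mul]
        push_cast
        ring
      rw [h2]
      refine (abs_add_le _ _).trans ?_
      rw [abs_mul]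
      have := mul_le_mul (hm a) h1 (abs_nonneg _) (by positivity)
      linarith [hN i]
    rw [Finset.sum_insert has, ← add_assoc, mul_assoc]
    refine (mul_le_mul_of_nonneg_left (h₁ n (by omega) N hN (m a) (hm a)) hκ₂.le).trans ?_
    exact h₂ n (by omega) _ hN' m hm

end Ratio

/-- The self-information of any string of type `N`. -/
noncomputable def typeInfo {d : ℕ} (p : Fin d → ℝ) (N : Fin d → ℤ) : ℝ :=
  -∑ a, N a * Real.log (p a)

/-- The self-information of type `N` lies in `(α - c, α]`. -/
def InWindow {d : ℕ} (p : Fin d → ℝ) (α c : ℝ) (N : Fin d → ℤ) : Prop :=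
  typeInfo p N ≤ α ∧ α - c < typeInfo p N

section Window

variable {d : ℕ} {p : Fin d → ℝ}

lemma neg_log_prodP (hpos : ∀ i, 0 < p i) {n : ℕ} (x : Fin n → Fin d) :
    -Real.log (prodP p x) = typeInfo p (strType x) := by
  unfold prodP typeInfo strType
  rw [Real.log_prod fun k _ => (hpos (x k)).ne']
  push_cast
  simp_rw [Finset.sum_mul]
  rw [Finset.sum_comm]
  simp

lemma typeInfo_add (N v : Fin d → ℤ) : typeInfo p (N + v) = typeInfo p N + typeInfo p v := by
  simp only [typeInfo, Pi.add_apply, Int.cast_add, add_mul, Finset.sum_add_distrib, neg_add]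

lemma typeInfo_smul (k : ℤ) (v : Fin d → ℤ) : typeInfo p (k • v) = k * typeInfo p v := by
  simp only [typeInfo, Pi.smul_apply, smul_eq_mul, Int.cast_mul, mul_assoc, ← Finset.mul_sum,
    mul_neg]

lemma typeInfo_sub (N v : Fin d → ℤ) : typeInfo p (N - v) = typeInfo p N - typeInfo p v :=
  eq_sub_of_add_eq (by rw [← typeInfo_add, sub_add_cancel])

lemma typeInfo_sum {ι : Type*} (s : Finset ι) (v : ι → Fin d → ℤ) :
    typeInfo p (∑ a ∈ s, v a) = ∑ a ∈ s, typeInfo p (v a) := by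
  induction s using Finset.induction_on with
  | empty => simp [typeInfo]
  | insert a s has ih => rw [Finset.sum_insert has, Finset.sum_insert has, typeInfo_add, ih]

lemma typeInfo_swapVec (a b : Fin d) :
    typeInfo p (swapVec a b) = Real.log (p b) - Real.log (p a) := by
  simp [typeInfo, swapVec, Pi.single_apply, sub_mul, Finset.sum_sub_distrib]

lemma card_le_of_diameter_lt {c δ : ℝ} (hδ : 0 < δ) (s : Finset ℕ)
    (h : ∀ k ∈ s, ∀ l ∈ s, ((l : ℝ) - k) * δ < c) : s.card ≤ ⌈c / δ⌉₊ + 1 := by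
  rcases s.eq_empty_or_nonempty with rfl | hs
  · simp
  have hsub : s ⊆ Finset.Icc (s.min' hs) (s.min' hs + ⌈c / δ⌉₊) := by
    intro l hl
    rw [Finset.mem_Icc]
    refine ⟨Finset.min'_le _ _ hl, ?_⟩
    have h1 := h _ (Finset.min'_mem s hs) l hl
    rw [← lt_div_iff₀ hδ] at h1
    have h2 : (l : ℝ) ≤ (s.min' hs + ⌈c / δ⌉₊ : ℕ) := by
      push_cast
      linarith [Nat.le_ceil (c / δ)]
    exact_mod_cast h2
  refine (Finset.card_le_card hsub).trans ?_
  simp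
  omega

lemma exists_probType_unbalanced_window_le (hpos : ∀ i, 0 < p i) (hsum : ∑ i, p i = 1)
    {a b : Fin d} (hne : p a ≠ p b) {η : ℝ} (hη : 0 < η) (c : ℝ) :
    ∃ K > 0, ∃ N₀ : ℕ, ∀ n ≥ N₀, ∀ α : ℝ,
      probType p n (fun N => InWindow p α c N ∧ η * n ≤ N b ∧ N a * p b ≤ N b * p a)
        ≤ K / √n := by
  have hab : a ≠ b := fun h => hne (h ▸ rfl)
  set e := swapVec a b with he
  have hδ : 0 < |typeInfo p e| := by
    rw [he, typeInfo_swapVec, abs_pos, sub_ne_zero]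
    exact fun h => hne (Real.log_injOn_pos (hpos b) (hpos a) h).symm
  obtain ⟨κ, hκ, N₀, hN₀⟩ := exists_swap_ratio hpos hab hη le_rfl zero_le_one
  set M := ⌈c / |typeInfo p e|⌉₊ + 1 with hM
  refine ⟨M / κ, by positivity, N₀ + 1, fun n hn α => ?_⟩
  have hq : 0 < √(n : ℝ) := Real.sqrt_pos.2 (by exact_mod_cast (by omega : 0 < n))
  obtain ⟨F, hF, hprob⟩ := exists_probType_eq_sum n p
    (fun N => InWindow p α c N ∧ η * n ≤ N b ∧ N a * p b ≤ N b * p a)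
  rw [hprob]
  set T := Nat.sqrt n + 1 with hT
  have step : ∀ k ∈ Finset.range T, κ * ∑ N ∈ F, typeProb p n N
      ≤ probType p n (fun N => InWindow p α c (N - (k : ℤ) • e)) := by
    intro k hk
    have hk' : (k : ℝ) ≤ 1 * √n := by
      rw [one_mul]
      refine le_trans ?_ Real.nat_sqrt_le_real_sqrt
      exact_mod_cast Nat.lt_succ_iff.1 (Finset.mem_range.1 hk)
    calc κ * ∑ N ∈ F, typeProb p n N
        ≤ ∑ N ∈ F, typeProb p n (N + (k : ℤ) • e) := by
          rw [Finset.mul_sum]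
          refine Finset.sum_le_sum fun N hN => ?_
          obtain ⟨⟨x, rfl⟩, -, h2, h3⟩ := hF N hN
          exact hN₀ n (by omega) _ (strType_nonneg x a) h2 (by linarith) k hk'
      _ = ∑ N ∈ F.image (· + (k : ℤ) • e), typeProb p n N :=
          (Finset.sum_image fun x _ y _ h => add_right_cancel h).symm
      _ ≤ _ := by
          refine sum_typeProb_le hpos _ fun N hN => ?_
          obtain ⟨N', hN', rfl⟩ := Finset.mem_image.1 hN
          rw [add_sub_cancel_right]
          exact (hF N' hN').2.1
  have total : ∑ k ∈ Finset.range T,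
      probType p n (fun N => InWindow p α c (N - (k : ℤ) • e)) ≤ M := by
    unfold probType
    rw [Finset.sum_comm]
    calc _ ≤ ∑ x : Fin n → Fin d, prodP p x * M := by
          refine Finset.sum_le_sum fun x _ => ?_
          rw [← Finset.sum_filter, Finset.sum_const, nsmul_eq_mul, mul_comm]
          refine mul_le_mul_of_nonneg_left ?_ (prodP_pos hpos x).le
          have hcard := card_le_of_diameter_lt (c := c) hδ
            ((Finset.range T).filter fun k : ℕ => InWindow p α c (strType x - (k : ℤ) • e)) ?_
          · exact_mod_cast hcard
          · intro k hk l hl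
            obtain ⟨-, h1, h2⟩ := Finset.mem_filter.1 hk
            obtain ⟨-, h3, h4⟩ := Finset.mem_filter.1 hl
            rw [typeInfo_sub, typeInfo_smul, Int.cast_natCast] at h1 h2 h3 h4
            rcases abs_cases (typeInfo p e) with ⟨h, -⟩ | ⟨h, -⟩ <;> rw [h] <;> linarith
      _ = M := by rw [← Finset.sum_mul, sum_prodP hsum, one_mul]
  have h1 := Finset.sum_le_sum step
  rw [Finset.sum_const, Finset.card_range, nsmul_eq_mul] at h1
  have h2 : √(n : ℝ) ≤ T := by
    rw [hT]; push_cast; exact Real.real_sqrt_le_nat_sqrt_succ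
  have h3 : 0 ≤ ∑ N ∈ F, typeProb p n N := Finset.sum_nonneg fun N _ => typeProb_nonneg hpos N
  rw [le_div_iff₀ hq, le_div_iff₀ hκ]
  calc _ = √(n : ℝ) * (κ * ∑ N ∈ F, typeProb p n N) := by ring
    _ ≤ T * (κ * ∑ N ∈ F, typeProb p n N) := by gcongr
    _ ≤ M := h1.trans total

lemma exists_probType_window_le (hpos : ∀ i, 0 < p i) (hsum : ∑ i, p i = 1)
    {i j : Fin d} (hne : p i ≠ p j) (c : ℝ) :
    ∃ K > 0, ∃ N₀ : ℕ, ∀ n ≥ N₀, ∀ α : ℝ, probType p n (InWindow p α c) ≤ K / √n := by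
  have hi := hpos i
  have hj := hpos j
  obtain ⟨K₁, hK₁, N₁, h₁⟩ :=
    exists_probType_unbalanced_window_le hpos hsum hne (half_pos hj) c
  obtain ⟨K₂, hK₂, N₂, h₂⟩ :=
    exists_probType_unbalanced_window_le hpos hsum hne.symm (half_pos hi) c
  refine ⟨K₁ + K₂ + (4 / p i ^ 2 + 4 / p j ^ 2), by positivity, N₁ + N₂ + 1, fun n hn α => ?_⟩
  have hn1 : (1 : ℝ) ≤ n := by exact_mod_cast (by omega : 1 ≤ n)
  have hq : 0 < √(n : ℝ) := Real.sqrt_pos.2 (by linarith)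
  have hqn : √(n : ℝ) ≤ n := by
    rw [Real.sqrt_le_left (by linarith)]; nlinarith
  have dev : ∀ l, probType p n (fun N => p l / 2 * n ≤ |(N l : ℝ) - n * p l|)
      ≤ 4 / p l ^ 2 / √n := by
    intro l
    have hl := hpos l
    refine (probType_deviation_le hpos hsum l (by positivity)).trans ?_
    calc (n : ℝ) / (p l / 2 * n) ^ 2 = 4 / p l ^ 2 / n := by field_simp; norm_num
      _ ≤ _ := by gcongr
  have split : probType p n (InWindow p α c)
      ≤ probType p n (fun N => InWindow p α c N ∧ p j / 2 * n ≤ N j ∧ N i * p j ≤ N j * p i)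
        + (probType p n
            (fun N => InWindow p α c N ∧ p i / 2 * n ≤ N i ∧ N j * p i ≤ N i * p j)
        + (probType p n (fun N => p i / 2 * n ≤ |(N i : ℝ) - n * p i|)
        + probType p n (fun N => p j / 2 * n ≤ |(N j : ℝ) - n * p j|))) := by
    refine (probType_le_add hpos (S := fun N => (InWindow p α c N ∧ p i / 2 * n ≤ N i ∧
      N j * p i ≤ N i * p j) ∨ (p i / 2 * n ≤ |(N i : ℝ) - n * p i|) ∨
      p j / 2 * n ≤ |(N j : ℝ) - n * p j|) ?_).trans (add_le_add le_rfl
      ((probType_le_add hpos (S := fun N => (p i / 2 * n ≤ |(N i : ℝ) - n * p i|) ∨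
      p j / 2 * n ≤ |(N j : ℝ) - n * p j|) fun x h => h).trans
      (add_le_add le_rfl (probType_le_add hpos fun x h => h))))
    intro x hx
    by_cases hxi : p i / 2 * n ≤ strType x i
    · by_cases hxj : p j / 2 * n ≤ strType x j
      · rcases le_total (strType x i * p j) (strType x j * p i) with h | h
        · exact Or.inl ⟨hx, hxj, h⟩
        · exact Or.inr (Or.inl ⟨hx, hxi, h⟩)
      · refine Or.inr (Or.inr (Or.inr ?_))
        rw [abs_sub_comm]
        exact le_trans (by linarith) (le_abs_self _)
    · refine Or.inr (Or.inr (Or.inl ?_))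
      rw [abs_sub_comm]
      exact le_trans (by linarith) (le_abs_self _)
  refine split.trans ?_
  rw [add_div, add_div, add_div]
  linarith [h₁ n (by omega) α, h₂ n (by omega) α, dev i, dev j]

lemma half_le_probType_central (hpos : ∀ i, 0 < p i) (hsum : ∑ i, p i = 1) {n : ℕ} (hn : 0 < n)
    (hd : 0 < d) :
    1 / 2 ≤ probType p n (fun N => ∀ i, |N i - n * p i| ≤ 2 * d * √n) := by
  have hd' : (1 : ℝ) ≤ d := by exact_mod_cast hd
  have hn' : (0 : ℝ) < n := by exact_mod_cast hn
  have hq : 0 < √(n : ℝ) := Real.sqrt_pos.2 hn'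
  have h1 : 1 ≤ probType p n (fun N => ∀ i, |N i - n * p i| ≤ 2 * d * √n)
      + ∑ i, probType p n (fun N => 2 * d * √n ≤ |(N i : ℝ) - n * p i|) := by
    rw [← sum_prodP hsum n]
    unfold probType
    rw [Finset.sum_comm, ← Finset.sum_add_distrib]
    refine Finset.sum_le_sum fun x _ => ?_
    have hP := (prodP_pos hpos x).le
    have hs : ∀ i, 0 ≤ if 2 * d * √n ≤ |(strType x i : ℝ) - n * p i| then prodP p x else 0 :=
      fun i => by split_ifs <;> [exact hP; rfl]
    by_cases h : ∀ i, |(strType x i : ℝ) - n * p i| ≤ 2 * d * √n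
    · rw [if_pos h]
      linarith [Finset.sum_nonneg fun i (_ : i ∈ Finset.univ) => hs i]
    · rw [if_neg h, zero_add]
      push Not at h
      obtain ⟨i, hi⟩ := h
      refine le_trans ?_ (Finset.single_le_sum (fun i _ => hs i) (Finset.mem_univ i))
      rw [if_pos hi.le]
  have h2 : ∑ i, probType p n (fun N => 2 * d * √n ≤ |(N i : ℝ) - n * p i|) ≤ 1 / 2 := by
    calc ∑ i, probType p n (fun N => 2 * d * √n ≤ |(N i : ℝ) - n * p i|)
        ≤ ∑ _i : Fin d, (1 : ℝ) / (4 * (d : ℝ) ^ 2) := by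
          refine Finset.sum_le_sum fun i _ => ?_
          refine (probType_deviation_le hpos hsum i (by positivity)).trans (le_of_eq ?_)
          rw [mul_pow, mul_pow, Real.sq_sqrt hn'.le]
          field_simp
          norm_num
      _ = 1 / (4 * (d : ℝ)) := by
          rw [Finset.sum_const, Finset.card_univ, Fintype.card_fin, nsmul_eq_mul]
          field_simp
      _ ≤ 1 / 2 := by
          rw [div_le_div_iff₀ (by positivity) (by norm_num)]
          linarith
  linarith

lemma exists_le_probType_window (hpos : ∀ i, 0 < p i) (hsum : ∑ i, p i = 1) (o : Fin d)
    (m : Fin d → ℤ) {c : ℝ} (hg : 0 < typeInfo p (∑ a, m a • swapVec a o))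
    (hgc : typeInfo p (∑ a, m a • swapVec a o) ≤ c) (τ : ℝ) :
    ∃ K > 0, ∃ N₀ : ℕ, ∀ n ≥ N₀,
      K / √n ≤ probType p n (InWindow p (n * shannonH p + √n * τ) c) := by
  set w := ∑ a, m a • swapVec a o with hw
  set g := typeInfo p w with hgdef
  set B : ℝ := 2 * d with hB
  set L : ℝ := ∑ a, |Real.log (p a)| with hL
  set M : ℝ := ∑ a, |(m a : ℝ)| with hM
  have hB0 : 0 ≤ B := by positivity
  have hL0 : 0 ≤ L := Finset.sum_nonneg fun _ _ => abs_nonneg _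
  have hM0 : 0 ≤ M := Finset.sum_nonneg fun _ _ => abs_nonneg _
  set A : ℝ := (|τ| + B * L) / g + 1 with hA
  have hA0 : 0 ≤ A := by positivity
  obtain ⟨κ, hκ, N₀, hN₀⟩ :=
    exists_shift_ratio_central hpos o (A := A * M) (by positivity) Finset.univ hB0
  refine ⟨κ / (2 * (2 * A + 1)), by positivity, N₀ + 1, fun n hn => ?_⟩
  have hn1 : (1 : ℝ) ≤ n := by exact_mod_cast (by omega : 1 ≤ n)
  have hq1 : 1 ≤ √(n : ℝ) := Real.one_le_sqrt.2 hn1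
  set α : ℝ := n * shannonH p + √n * τ with hα
  set T : ℤ := ⌊A * √n⌋ with hT
  have hT0 : 0 ≤ T := Int.floor_nonneg.2 (by positivity)
  have hcentral := half_le_probType_central hpos hsum (n := n) (by omega) o.pos
  obtain ⟨F, hF, hprob⟩ := exists_probType_eq_sum n p
    (fun N => ∀ i, |N i - n * p i| ≤ B * √n)
  rw [hprob] at hcentral
  have move : ∀ N ∈ F, ∃ k ∈ Finset.Icc (-T) T, InWindow p α c (N + k • w) ∧
      κ * typeProb p n N ≤ typeProb p n (N + k • w) := by
    intro N hN
    have hNc := (hF N hN).2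
    have hu : |α - typeInfo p N| ≤ (|τ| + B * L) * √n := by
      have e : α - typeInfo p N
          = √n * τ + ∑ a, (N a - n * p a) * Real.log (p a) := by
        rw [hα, typeInfo, shannonH]
        simp only [sub_mul, Finset.sum_sub_distrib, mul_neg, Finset.mul_sum, mul_assoc]
        ring
      rw [e]
      refine (abs_add_le _ _).trans ?_
      rw [abs_mul, abs_of_nonneg (Real.sqrt_nonneg _)]
      have : |∑ a, (N a - n * p a) * Real.log (p a)| ≤ B * √n * L := by
        refine (Finset.abs_sum_le_sum_abs _ _).trans ?_
        rw [hL, Finset.mul_sum]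
        refine Finset.sum_le_sum fun a _ => ?_
        rw [abs_mul]
        exact mul_le_mul_of_nonneg_right (hNc a) (abs_nonneg _)
      linarith
    set k : ℤ := ⌊(α - typeInfo p N) / g⌋ with hk
    have hk1 : k * g ≤ α - typeInfo p N := (le_div_iff₀ hg).1 (Int.floor_le _)
    have hk2 : α - typeInfo p N < (k + 1) * g := (div_lt_iff₀ hg).1 (Int.lt_floor_add_one _)
    have hkA : |(k : ℝ)| ≤ A * √n := by
      have h1 : A * √n * g = (|τ| + B * L) * √n + √n * g := by
        rw [hA]; field_simp
      have h2 : g ≤ √n * g := by nlinarith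
      have hu' := abs_le.1 hu
      rw [abs_le]
      constructor <;> refine le_of_mul_le_mul_right ?_ hg <;> nlinarith
    refine ⟨k, ?_, ?_, ?_⟩
    · rw [Finset.mem_Icc, ← abs_le, hT, Int.le_floor]
      exact_mod_cast hkA
    · unfold InWindow
      rw [typeInfo_add, typeInfo_smul]
      constructor <;> nlinarith
    · have := hN₀ n (by omega) N hNc (fun a => k * m a) fun a => by
        have h1 : |(m a : ℝ)| ≤ M :=
          Finset.single_le_sum (f := fun a => |(m a : ℝ)|) (fun _ _ => abs_nonneg _)
            (Finset.mem_univ a)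
        push_cast
        rw [abs_mul]
        have := mul_le_mul hkA h1 (abs_nonneg _) (by positivity)
        linarith
      simpa only [hw, Finset.smul_sum, smul_smul] using this
  set P := probType p n (InWindow p α c) with hP
  have key : κ * ∑ N ∈ F, typeProb p n N ≤ (2 * T + 1) * P := by
    calc κ * ∑ N ∈ F, typeProb p n N
        ≤ ∑ N ∈ F, ∑ k ∈ Finset.Icc (-T) T,
            if InWindow p α c (N + k • w) then typeProb p n (N + k • w) else 0 := by
          rw [Finset.mul_sum]
          refine Finset.sum_le_sum fun N hN => ?_
          obtain ⟨k, hk, h1, h2⟩ := move N hN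
          refine h2.trans ?_
          rw [← if_pos (c := InWindow p α c (N + k • w)) (t := typeProb p n (N + k • w))
            (e := 0) h1]
          exact Finset.single_le_sum
            (f := fun k : ℤ => if InWindow p α c (N + k • w) then typeProb p n (N + k • w) else 0)
            (fun k _ => by split_ifs <;> [exact typeProb_nonneg hpos _; rfl]) hk
      _ = ∑ k ∈ Finset.Icc (-T) T, ∑ N ∈ F,
            if InWindow p α c (N + k • w) then typeProb p n (N + k • w) else 0 :=
          Finset.sum_comm
      _ ≤ ∑ k ∈ Finset.Icc (-T) T, P := by
          refine Finset.sum_le_sum fun k _ => ?_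
          rw [← Finset.sum_filter,
            ← Finset.sum_image (g := fun N => N + k • w) (f := typeProb p n)
              fun x _ y _ h => add_right_cancel h]
          refine sum_typeProb_le hpos _ fun N hN => ?_
          obtain ⟨N', hN', rfl⟩ := Finset.mem_image.1 hN
          exact (Finset.mem_filter.1 hN').2
      _ = (2 * T + 1) * P := by
          rw [Finset.sum_const, nsmul_eq_mul, Int.card_Icc]
          congr 1
          have : ((T + 1 - -T).toNat : ℤ) = 2 * T + 1 := by omega
          exact_mod_cast this
  have hTle : (2 * T + 1 : ℝ) ≤ (2 * A + 1) * √n := by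
    have : (T : ℝ) ≤ A * √n := Int.floor_le _
    linarith
  have hP0 : 0 ≤ P := Finset.sum_nonneg fun x _ => by
    split_ifs <;> [exact (prodP_pos hpos x).le; rfl]
  rw [div_div, div_le_iff₀ (by positivity)]
  nlinarith [mul_le_mul_of_nonneg_right hTle hP0, mul_le_mul_of_nonneg_left hcentral hκ.le]

lemma exists_small_typeInfo (hpos : ∀ i, 0 < p i) {i j : Fin d} (hne : p i ≠ p j) {c : ℝ}
    (hc : 0 < c) (hlat : (∀ c₀ : ℝ, ¬ IsLatticeSpan p c₀) ∨ IsLatticeSpan p c) (o : Fin d) :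
    ∃ m : Fin d → ℤ, 0 < typeInfo p (∑ a, m a • swapVec a o) ∧
      typeInfo p (∑ a, m a • swapVec a o) ≤ c := by
  set G : Submodule ℤ ℝ := Submodule.span ℤ (Set.range fun a => typeInfo p (swapVec a o)) with hG
  suffices h : ∃ g ∈ G, 0 < g ∧ g ≤ c by
    obtain ⟨g, hgG, h0, h1⟩ := h
    obtain ⟨m, rfl⟩ := (Submodule.mem_span_range_iff_exists_fun ℤ).1 hgG
    refine ⟨m, ?_⟩
    simp only [typeInfo_sum, typeInfo_smul]
    simp only [zsmul_eq_mul] at h0 h1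
    exact ⟨h0, h1⟩
  have hdiff : ∀ a b, Real.log (p a) - Real.log (p b) ∈ G := by
    intro a b
    have ha : typeInfo p (swapVec a o) ∈ G := Submodule.subset_span ⟨a, rfl⟩
    have hb : typeInfo p (swapVec b o) ∈ G := Submodule.subset_span ⟨b, rfl⟩
    have := G.sub_mem hb ha
    simp only [typeInfo_swapVec] at this
    convert this using 1
    ring
  rcases AddSubgroup.dense_or_cyclic G.toAddSubgroup with hdense | ⟨a, ha⟩
  · obtain ⟨g, hgG, hg⟩ := hdense.exists_mem_open isOpen_Ioo
      (Set.nonempty_Ioo.2 hc)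
    exact ⟨g, hgG, hg.1, hg.2.le⟩
  · have hmem : ∀ g : ℝ, g ∈ G ↔ ∃ k : ℤ, g = k * |a| := by
      intro g
      rw [← Submodule.mem_toAddSubgroup, ha, AddSubgroup.mem_closure_singleton]
      simp only [zsmul_eq_mul]
      rcases abs_choice a with h | h <;> rw [h]
      · exact ⟨fun ⟨k, hk⟩ => ⟨k, hk.symm⟩, fun ⟨k, hk⟩ => ⟨k, hk.symm⟩⟩
      · exact ⟨fun ⟨k, hk⟩ => ⟨-k, by push_cast; linarith⟩,
          fun ⟨k, hk⟩ => ⟨-k, by push_cast; linarith⟩⟩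
    have ha0 : 0 < |a| := by
      rw [abs_pos]
      rintro rfl
      obtain ⟨k, hk⟩ := (hmem _).1 (hdiff i j)
      rw [abs_zero, mul_zero, sub_eq_zero] at hk
      exact hne (Real.log_injOn_pos (hpos i) (hpos j) hk)
    have hall : ∀ i j, ∃ k : ℤ, Real.log (p i) - Real.log (p j) = k * |a| :=
      fun i j => (hmem _).1 (hdiff i j)
    have haG : |a| ∈ G := (hmem _).2 ⟨1, by simp⟩
    rcases hlat with hlat | hlat
    · refine absurd ⟨ha0, hall, fun c' hc' h => ?_⟩ (hlat |a|)
      have hle : G ≤ Submodule.span ℤ {c'} := by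
        rw [hG, Submodule.span_le]
        rintro _ ⟨b, rfl⟩
        obtain ⟨k, hk⟩ := h o b
        rw [SetLike.mem_coe, Submodule.mem_span_singleton]
        exact ⟨k, by rw [zsmul_eq_mul, ← hk]; exact (typeInfo_swapVec b o).symm⟩
      obtain ⟨k, hk⟩ := Submodule.mem_span_singleton.1 (hle haG)
      rw [zsmul_eq_mul] at hk
      have hk0 : 0 < (k : ℝ) := pos_of_mul_pos_left (hk ▸ ha0) hc'.le
      have hk1 : (1 : ℝ) ≤ k := by
        have : 0 < k := by exact_mod_cast hk0
        exact_mod_cast (by omega : 1 ≤ k)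
      nlinarith
    · exact ⟨|a|, haG, ha0, hlat.2.2 _ ha0 hall⟩

end Window

theorem stmt14 {d : ℕ} (p : Fin d → ℝ)
    (hpos : ∀ i, 0 < p i) (hsum : ∑ i, p i = 1)
    (hnonunif : ∃ i j, p i ≠ p j)
    (ε : ℝ) (hε : ε ∈ Set.Ioo (0 : ℝ) 1)
    (c : ℝ) (hc : 0 < c)
    (hlat : (∀ c₀ : ℝ, ¬ IsLatticeSpan p c₀) ∨ IsLatticeSpan p c) :
    ∃ (C : ℝ) (N : ℕ), ∀ n ≥ N,
      |Real.log ((Rslab p ε c n 0).card) -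
        ((n : ℝ) * shannonH p + Real.sqrt n * Real.sqrt (varH p) * PhiInv ε
          - (1 / 2) * Real.log n)| ≤ C := by
  obtain ⟨i, j, hne⟩ := hnonunif
  set τ : ℝ := √(varH p) * PhiInv ε with hτ
  obtain ⟨K₂, hK₂, N₂, h₂⟩ := exists_probType_window_le hpos hsum hne c
  obtain ⟨m, hm0, hmc⟩ := exists_small_typeInfo hpos hne hc hlat i
  obtain ⟨K₁, hK₁, N₁, h₁⟩ := exists_le_probType_window hpos hsum i m hm0 hmc τ
  refine ⟨|Real.log K₁| + |Real.log K₂| + c, N₁ + N₂ + 1, fun n hn => ?_⟩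
  have hn0 : (0 : ℝ) < n := by exact_mod_cast (by omega : 0 < n)
  have hq : 0 < √(n : ℝ) := Real.sqrt_pos.2 hn0
  set α : ℝ := n * shannonH p + √n * τ with hα
  have hαeq : (n : ℝ) * shannonH p + √n * √(varH p) * PhiInv ε = α := by
    rw [hα, hτ]; ring
  rw [hαeq]
  have hslab : ∀ x : Fin n → Fin d, x ∈ Rslab p ε c n 0 ↔ InWindow p α c (strType x) := by
    intro x
    simp only [Rslab, Finset.mem_filter, Finset.mem_univ, true_and, hαeq, InWindow,
      neg_log_prodP hpos, Nat.cast_zero, mul_zero, sub_zero, zero_add, mul_one]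
  have hprob : probType p n (InWindow p α c) = ∑ x ∈ Rslab p ε c n 0, prodP p x := by
    rw [probType, ← Finset.sum_filter]
    refine Finset.sum_congr ?_ fun _ _ => rfl
    ext x
    simp [hslab]
  have hbounds : ∀ x ∈ Rslab p ε c n 0,
      Real.exp (-α) ≤ prodP p x ∧ prodP p x ≤ Real.exp (c - α) := by
    intro x hx
    obtain ⟨h1, h2⟩ := (hslab x).1 hx
    rw [← neg_log_prodP hpos] at h1 h2
    rw [← Real.exp_log (prodP_pos hpos x), Real.exp_le_exp, Real.exp_le_exp]
    constructor <;> linarith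
  set R : ℝ := ((Rslab p ε c n 0).card : ℝ) with hR
  have hlow := h₁ n (by omega)
  have hupp := h₂ n (by omega) α
  have hRupp : R * Real.exp (-α) ≤ K₂ / √n := by
    refine le_trans ?_ hupp
    rw [hprob, hR, ← nsmul_eq_mul]
    exact Finset.card_nsmul_le_sum _ _ _ fun x hx => (hbounds x hx).1
  have hRlow : K₁ / √n ≤ R * Real.exp (c - α) := by
    refine hlow.trans ?_
    rw [hprob, hR, ← nsmul_eq_mul]
    exact Finset.sum_le_card_nsmul _ _ _ fun x hx => (hbounds x hx).2
  have hRpos : 0 < R := by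
    have : 0 < R * Real.exp (c - α) := lt_of_lt_of_le (by positivity) hRlow
    exact pos_of_mul_pos_left this (Real.exp_pos _).le
  have l1 := Real.log_le_log (by positivity) hRupp
  have l2 := Real.log_le_log (by positivity) hRlow
  rw [Real.log_mul hRpos.ne' (Real.exp_ne_zero _), Real.log_exp,
    Real.log_div (by positivity) hq.ne', Real.log_sqrt hn0.le] at l1 l2
  rw [abs_le]
  constructor <;>
    linarith [neg_abs_le (Real.log K₁), le_abs_self (Real.log K₂), abs_nonneg (Real.log K₁),
      abs_nonneg (Real.log K₂)]
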